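/- arXiv:1812.03960 — 2 statements merged into one kernel-verified Lean document; each statement's English description precedes it below -/
import Mathlib

section
/- For every real ρ > 0 there exists a constant C > 0 such that for all natural numbers n ≥ 2, the number of simple graphs on Fin n that admit a radius-ρ uniform ball representation in the hyperbolic plane ℍ is at most 2^(C · n · log n). -/
open MvPolynomial

theorem aux_totalDegree_pderiv {σ : Type*} (p : MvPolynomial σ ℝ) (i : σ) :
    (pderiv i p).totalDegree ≤ p.totalDegree := by
  classical
  rw [totalDegree]
  refine Finset.sup_le fun d hd => ?_
  rw [mem_support_iff, coeff_pderiv] at hd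
  have h1 : d + Finsupp.single i 1 ∈ p.support := by
    rw [mem_support_iff]
    intro h
    simp [h] at hd
  have h2 := le_totalDegree h1
  refine le_trans ?_ h2
  rw [Finsupp.sum_add_index' (by simp) (by simp)]
  exact Nat.le_add_right _ _

theorem aux_hasDerivAt {σ : Type*} [DecidableEq σ] (p : MvPolynomial σ ℝ) (i : σ) (x : σ → ℝ) (t : ℝ) :
    HasDerivAt (fun t => eval (Function.update x i t) p)
      (eval (Function.update x i t) (pderiv i p)) t := by
  induction p using MvPolynomial.induction_on with
  | C a => simpa using hasDerivAt_const t a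
  | add p q hp hq => 
    simp only [map_add]
    exact hp.add hq
  | mul_X p j hp =>
    have hX : HasDerivAt (fun t => Function.update x i t j)
        (eval (Function.update x i t) (pderiv i (X j : MvPolynomial σ ℝ))) t := by
      by_cases h : j = i
      · subst h
        simp only [Function.update_self, pderiv_X_self, map_one]
        exact hasDerivAt_id t
      · simpa [h, pderiv_X_of_ne h] using hasDerivAt_const t (x j)
    have := hp.mul hX
    simp only [pderiv_mul, map_mul, map_add, eval_X]
    exact this

/-- dimension count: delta-family of polynomials of total degree at most `E`. -/
theorem aux_dim {σ ι : Type*} [Fintype σ] [Fintype ι] (E : ℕ) (pt : ι → σ → ℝ)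
    (p : ι → MvPolynomial σ ℝ) (hdeg : ∀ a, (p a).totalDegree ≤ E)
    (hself : ∀ a, eval (pt a) (p a) ≠ 0)
    (hne : ∀ a b, a ≠ b → eval (pt b) (p a) = 0) :
    Fintype.card ι ≤ (E + 1) ^ Fintype.card σ := by
  classical
  have hmem : ∀ a, p a ∈ restrictDegree σ ℝ E := fun a =>
    restrictTotalDegree_le_restrictDegree σ ℝ E ((mem_restrictTotalDegree _ _ _).2 (hdeg a))
  have hli : LinearIndependent ℝ (fun a => (⟨p a, hmem a⟩ : restrictDegree σ ℝ E)) := by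
    rw [Fintype.linearIndependent_iff]
    intro g hg b
    have h1 := congrArg (fun q : restrictDegree σ ℝ E => eval (pt b) (q : MvPolynomial σ ℝ)) hg
    simp only [Submodule.coe_sum, Submodule.coe_smul, map_sum, smul_eval, Submodule.coe_zero,
      map_zero] at h1
    rw [Finset.sum_eq_single b (fun a _ hab => by rw [hne a b hab, mul_zero]) (by simp)] at h1
    exact (mul_eq_zero.1 h1).resolve_right (hself b)
  let f : {n : σ →₀ ℕ | ∀ i, n i ≤ E} → (σ → Fin (E + 1)) :=
    fun n i => ⟨n.1 i, Nat.lt_succ_of_le (n.2 i)⟩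
  have hf : Function.Injective f := by
    intro m n h
    ext i
    exact congrArg Fin.val (congrFun h i)
  have := Fintype.ofInjective f hf
  have hb : Module.finrank ℝ (restrictDegree σ ℝ E) = Fintype.card {n : σ →₀ ℕ | ∀ i, n i ≤ E} :=
    Module.finrank_eq_card_basis (basisRestrictSupport ℝ {n : σ →₀ ℕ | ∀ i, n i ≤ E})
  have hfin : Module.Finite ℝ (restrictDegree σ ℝ E) := 
    Module.Finite.of_basis (basisRestrictSupport ℝ {n : σ →₀ ℕ | ∀ i, n i ≤ E})
  calc Fintype.card ι ≤ Module.finrank ℝ (restrictDegree σ ℝ E) := hli.fintype_card_le_finrank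
    _ = _ := hb
    _ ≤ Fintype.card (σ → Fin (E + 1)) := Fintype.card_le_of_injective f hf
    _ = _ := by simp

/-- Weak Bezout. -/
theorem aux_bezout {σ κ : Type*} [Fintype σ] [Fintype κ] (D : ℕ) (f : σ → MvPolynomial σ ℝ)
    (hD : ∀ i, (f i).totalDegree ≤ D) (δ : ℝ) (hδ : 0 < δ)
    (hx : ∀ y : σ → ℝ, (∀ i, |y i| < δ) → ∃ x : κ → σ → ℝ, Function.Injective x ∧
      ∀ k i, eval (x k) (f i) = y i) :
    Fintype.card κ ≤ (Fintype.card σ * D + 2) ^ Fintype.card σ := by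
  classical
  rcases Nat.eq_zero_or_pos (Fintype.card κ) with h0 | hpos
  · simp [h0]
  set K := Fintype.card κ with hK
  set N := Fintype.card σ with hN
  let c : Fin K → ℝ := fun a => δ * (a : ℕ) / K
  have hKR : (0 : ℝ) < K := by exact_mod_cast hpos
  have hc : ∀ a, |c a| < δ := by
    intro a
    have ha : ((a : ℕ) : ℝ) < K := by exact_mod_cast a.2
    have : 0 ≤ c a := by positivity
    rw [abs_of_nonneg this, div_lt_iff₀ hKR]
    exact mul_lt_mul_of_pos_left ha hδ
  have hcinj : Function.Injective c := by
    intro a b hab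
    have h1 : δ * (a : ℕ) / K = δ * (b : ℕ) / K := hab
    field_simp at h1
    exact Fin.ext (by exact_mod_cast h1)
  have hx' : ∀ y : σ → Fin K, ∃ x : κ → σ → ℝ, Function.Injective x ∧
      ∀ k i, eval (x k) (f i) = c (y i) := fun y => hx (fun i => c (y i)) (fun i => hc _)
  choose x hxinj hxf using hx'
  have hsep : ∀ (y : σ → Fin K) (k l : κ), ∃ j : Option σ, k ≠ l → ∃ j', j = some j' ∧ x y k j' ≠ x y l j' := by
    intro y k l
    by_cases h : k = l
    · exact ⟨none, fun h' => absurd h h'⟩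
    · obtain ⟨j, hj⟩ := Function.ne_iff.1 (fun h' => h (hxinj y h'))
      exact ⟨some j, fun _ => ⟨j, rfl, hj⟩⟩
  choose j hj using hsep
  let lin : (σ → Fin K) → κ → κ → MvPolynomial σ ℝ := fun y k l =>
    match j y k l with
    | none => 1
    | some j' => X j' - C (x y l j')
  have hlindeg : ∀ y k l, (lin y k l).totalDegree ≤ 1 := by
    intro y k l
    simp only [lin]
    split
    · simp
    · exact (totalDegree_sub_C_le _ _).trans (by simp)
  have hlin1 : ∀ y k l, k ≠ l → eval (x y k) (lin y k l) ≠ 0 := by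
    intro y k l h
    obtain ⟨j', h1, h2⟩ := hj y k l h
    simp only [lin, h1]
    simpa using sub_ne_zero.2 h2
  have hlin2 : ∀ y k l, k ≠ l → eval (x y l) (lin y k l) = 0 := by
    intro y k l h
    obtain ⟨j', h1, h2⟩ := hj y k l h
    simp [lin, h1]
  let p : κ × (σ → Fin K) → MvPolynomial σ ℝ := fun a =>
    (∏ i, ∏ b ∈ Finset.univ.erase (a.2 i), (f i - C (c b))) *
      ∏ l ∈ Finset.univ.erase a.1, lin a.2 a.1 l
  have hdeg : ∀ a, (p a).totalDegree ≤ N * (K * D) + K := by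
    intro a
    refine (totalDegree_mul _ _).trans (add_le_add ?_ ?_)
    · refine (totalDegree_finsetProd _ _).trans ?_
      have : ∀ i ∈ (Finset.univ : Finset σ),
          (∏ b ∈ Finset.univ.erase (a.2 i), (f i - C (c b))).totalDegree ≤ K * D := by
        intro i _
        refine (totalDegree_finsetProd _ _).trans ?_
        refine (Finset.sum_le_card_nsmul _ _ D
          (fun b _ => (totalDegree_sub_C_le _ _).trans (hD i))).trans ?_
        rw [smul_eq_mul]
        refine Nat.mul_le_mul_right _ ((Finset.card_le_univ _).trans (by simp))
      refine (Finset.sum_le_card_nsmul _ _ _ this).trans ?_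
      simp [hN]
    · refine (totalDegree_finsetProd _ _).trans ?_
      refine (Finset.sum_le_card_nsmul _ _ 1 (fun b _ => hlindeg _ _ _)).trans ?_
      rw [smul_eq_mul, mul_one]
      exact Finset.card_le_univ _
  have key := aux_dim (N * (K * D) + K) (fun a : κ × (σ → Fin K) => x a.2 a.1) p hdeg
    (by
      rintro ⟨k, y⟩
      simp only [p, map_mul, map_prod, mul_ne_zero_iff, Finset.prod_ne_zero_iff]
      refine ⟨fun i _ b hb => ?_, fun l hl => hlin1 _ _ _ (Finset.ne_of_mem_erase hl).symm⟩
      rw [map_sub, hxf, eval_C, sub_ne_zero]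
      exact fun h => Finset.ne_of_mem_erase hb (hcinj h).symm)
    (by
      rintro ⟨k, y⟩ ⟨l, z⟩ hne
      simp only [p, map_mul, map_prod]
      by_cases h : y = z
      · subst h
        have hkl : k ≠ l := fun h => hne (by rw [h])
        refine mul_eq_zero_of_right _ (Finset.prod_eq_zero (i := l) ?_ (hlin2 _ _ _ hkl))
        simp [hkl.symm]
      · obtain ⟨i, hi⟩ := Function.ne_iff.1 h
        refine mul_eq_zero_of_left (Finset.prod_eq_zero (Finset.mem_univ i)
          (Finset.prod_eq_zero (i := z i) ?_ ?_)) _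
        · simp [Ne.symm hi]
        · rw [map_sub, hxf, eval_C, sub_self])
  have hcard : Fintype.card (κ × (σ → Fin K)) = K * K ^ N := by simp [hK, hN]
  rw [hcard] at key
  have h2 : (N * (K * D) + K + 1) ^ N ≤ (N * D + 2) ^ N * K ^ N := by
    rw [← mul_pow]
    refine Nat.pow_le_pow_left ?_ _
    nlinarith
  exact Nat.le_of_mul_le_mul_right (key.trans h2) (by positivity)

/-- A small positive number below finitely many positive numbers. -/
theorem aux_small {κ : Type*} [Finite κ] (d : κ → ℝ) (hd : ∀ k, 0 < d k) :
    ∃ δ : ℝ, 0 < δ ∧ ∀ k, δ < d k := by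
  have h : ∀ᶠ δ in nhdsWithin (0 : ℝ) (Set.Ioi 0), ∀ k, δ < d k := by
    rw [Filter.eventually_all]
    intro k
    exact nhdsWithin_le_nhds (Iio_mem_nhds (hd k))
  have h' := h.and self_mem_nhdsWithin
  obtain ⟨δ, h1, h2⟩ := h'.exists
  exact ⟨δ, h2, h1⟩

theorem aux_crit {σ : Type*} [Fintype σ] (F : MvPolynomial σ ℝ) (S : Set (σ → ℝ))
    (hS : IsCompact S) (u : σ → ℝ) (hu : u ∈ S) (hFu : eval u F ≠ 0)
    (hnhds : ∀ x ∈ S, eval x F ≠ 0 → S ∈ nhds x) :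
    ∃ δ : ℝ, 0 < δ ∧ ∀ y : σ → ℝ, (∀ i, |y i| < δ) →
      ∃ x ∈ S, eval x F ≠ 0 ∧ ∀ i, eval x (pderiv i F) = y i := by
  classical
  obtain ⟨B, hB⟩ : ∃ B : ℝ, ∀ x ∈ S, ∑ i, |x i| ≤ B := by
    have hc : ContinuousOn (fun x : σ → ℝ => ∑ i, |x i|) S := by fun_prop
    obtain ⟨B, hB⟩ := hS.exists_bound_of_continuousOn hc
    exact ⟨B, fun x hx => (le_abs_self _).trans (hB x hx)⟩
  have hB0 : 0 ≤ B := (Finset.sum_nonneg fun i _ => abs_nonneg (u i)).trans (hB u hu)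
  have hM : 0 < |eval u F| := abs_pos.2 hFu
  set M := |eval u F| with hMdef
  refine ⟨M / (4 * (B + 1)), by positivity, fun y hy => ?_⟩
  let G : MvPolynomial σ ℝ := F - ∑ i, C (y i) * X i
  have hG : ∀ x, eval x G = eval x F - ∑ i, y i * x i := by
    intro x
    simp [G]
  have hGd : ∀ x i, eval x (pderiv i G) = eval x (pderiv i F) - y i := by
    intro x i
    simp [G, pderiv_X, Pi.single_apply]
  have hlin : ∀ x ∈ S, |∑ i, y i * x i| ≤ M / 4 := by
    intro x hx
    calc |∑ i, y i * x i| ≤ ∑ i, |y i * x i| := Finset.abs_sum_le_sum_abs _ _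
      _ ≤ ∑ i, M / (4 * (B + 1)) * |x i| := by
        refine Finset.sum_le_sum fun i _ => ?_
        rw [abs_mul]
        exact mul_le_mul_of_nonneg_right (hy i).le (abs_nonneg _)
      _ = M / (4 * (B + 1)) * ∑ i, |x i| := by rw [Finset.mul_sum]
      _ ≤ M / (4 * (B + 1)) * (B + 1) := by
        refine mul_le_mul_of_nonneg_left ?_ (by positivity)
        linarith [hB x hx]
      _ = M / 4 := by field_simp
  have hcont : ContinuousOn (fun x => |eval x G|) S :=
    (continuous_abs.comp (MvPolynomial.continuous_eval G)).continuousOn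
  obtain ⟨x, hxS, hxmax⟩ := hS.exists_isMaxOn ⟨u, hu⟩ hcont
  have h1 : |eval u G| ≤ |eval x G| := hxmax hu
  have h2 : M - M / 4 ≤ |eval u G| := by
    rw [hG]
    have := abs_sub_abs_le_abs_sub (eval u F) (∑ i, y i * u i)
    linarith [hlin u hu]
  have hGx : eval x G ≠ 0 := by
    intro h
    rw [h, abs_zero] at h1
    linarith
  have hFx : eval x F ≠ 0 := by
    intro h
    rw [hG x, h, zero_sub, abs_neg] at h1
    linarith [hlin x hxS]
  refine ⟨x, hxS, hFx, fun i => ?_⟩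
  have hder := (aux_hasDerivAt G i x (x i)).pow 2
  have hmax : IsLocalMax ((fun t => eval (Function.update x i t) G) ^ 2) (x i) := by
    have hc : Filter.Tendsto (fun t => Function.update x i t) (nhds (x i)) (nhds x) := by
      have : Continuous (fun t : ℝ => Function.update x i t) := by fun_prop
      simpa using this.tendsto (x i)
    filter_upwards [hc (hnhds x hxS hFx)] with t ht
    have h3 : |eval (Function.update x i t) G| ≤ |eval x G| := hxmax ht
    simp only [Pi.pow_apply, Function.update_eq_self]
    exact sq_le_sq.2 h3
  have h0 := hmax.hasDerivAt_eq_zero hder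
  simp only [Function.update_eq_self, hGd] at h0
  have h4 : eval x (pderiv i F) - y i = 0 := by
    rcases mul_eq_zero.1 h0 with h | h
    · exfalso
      simp [hGx] at h
    · exact h
  linarith

/-- Weak Warren bound for strict sign patterns. -/
theorem aux_strict {σ ι κ : Type*} [Fintype σ] [Fintype ι] [Fintype κ] (d : ℕ)
    (P : ι → MvPolynomial σ ℝ) (hP : ∀ i, (P i).totalDegree ≤ d) (u : κ → σ → ℝ)
    (hu : ∀ k i, eval (u k) (P i) ≠ 0)
    (hsep : ∀ k l, k ≠ l → ∃ i, eval (u k) (P i) * eval (u l) (P i) < 0) :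
    Fintype.card κ ≤ (Fintype.card σ * (2 + Fintype.card ι * d) + 2) ^ Fintype.card σ := by
  classical
  obtain ⟨R, hR⟩ : ∃ R : ℝ, ∀ k, ∑ j, u k j ^ 2 < R := by
    refine ⟨∑ k, ∑ j, u k j ^ 2 + 1, fun k => ?_⟩
    have := Finset.single_le_sum (f := fun k => ∑ j, u k j ^ 2)
      (fun k _ => Finset.sum_nonneg fun j _ => sq_nonneg _) (Finset.mem_univ k)
    linarith
  let Q : Option ι → MvPolynomial σ ℝ := fun o => o.elim (C R - ∑ j, X j ^ 2) P
  have hQ0 : ∀ x, eval x (Q none) = R - ∑ j, x j ^ 2 := by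
    intro x
    simp [Q]
  have hQu : ∀ k o, eval (u k) (Q o) ≠ 0 := by
    intro k o
    cases o with
    | none => rw [hQ0]; exact (sub_pos.2 (hR k)).ne'
    | some i => exact hu k i
  let F := ∏ o, Q o
  have hFne : ∀ x, eval x F ≠ 0 ↔ ∀ o, eval x (Q o) ≠ 0 := by
    intro x
    simp only [F, map_prod, Finset.prod_ne_zero_iff, Finset.mem_univ, true_imp_iff]
  have hFdeg : F.totalDegree ≤ 2 + Fintype.card ι * d := by
    refine (totalDegree_finsetProd _ _).trans ?_
    rw [Fintype.sum_option]
    refine add_le_add ?_ ?_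
    · refine (totalDegree_sub _ _).trans (max_le (by simp) ?_)
      exact totalDegree_finsetSum_le fun j _ => by simp
    · refine (Finset.sum_le_card_nsmul _ _ d (fun i _ => hP i)).trans ?_
      simp
  let S : κ → Set (σ → ℝ) := fun k => {x | ∀ o, 0 ≤ eval (u k) (Q o) * eval x (Q o)}
  have hcts : ∀ k o, Continuous fun x => eval (u k) (Q o) * eval x (Q o) := fun k o =>
    continuous_const.mul (MvPolynomial.continuous_eval _)
  have hScomp : ∀ k, IsCompact (S k) := by
    intro k
    refine Metric.isCompact_of_isClosed_isBounded ?_ ?_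
    · have : S k = ⋂ o, {x | 0 ≤ eval (u k) (Q o) * eval x (Q o)} := by
        ext x
        simp [S]
      rw [this]
      exact isClosed_iInter fun o => isClosed_le continuous_const (hcts k o)
    · refine (Metric.isBounded_closedBall (x := (0 : σ → ℝ)) (r := R + 1)).subset ?_
      intro x hx
      have h1 := hx none
      have h2 : 0 < eval (u k) (Q none) := by rw [hQ0]; exact sub_pos.2 (hR k)
      have h3 : 0 ≤ eval x (Q none) := nonneg_of_mul_nonneg_right h1 h2
      rw [hQ0] at h3
      have hR0 : 0 ≤ R := (Finset.sum_nonneg fun j _ => sq_nonneg _).trans (hR k).le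
      rw [mem_closedBall_zero_iff, pi_norm_le_iff_of_nonneg (by linarith)]
      intro j
      have h4 := Finset.single_le_sum (f := fun j => x j ^ 2)
        (fun j _ => sq_nonneg _) (Finset.mem_univ j)
      rw [Real.norm_eq_abs]
      refine abs_le_of_sq_le_sq ?_ (by linarith)
      nlinarith
  have hSpos : ∀ k x, x ∈ S k → eval x F ≠ 0 → ∀ o, 0 < eval (u k) (Q o) * eval x (Q o) := by
    intro k x hx hF o
    exact lt_of_le_of_ne (hx o) (mul_ne_zero (hQu k o) ((hFne x).1 hF o)).symm
  have hcrit := fun k => aux_crit F (S k) (hScomp k) (u k)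
    (fun o => mul_self_nonneg _) ((hFne _).2 (hQu k))
    (by
      intro x hx hF
      have : ∀ᶠ z in nhds x, ∀ o, 0 < eval (u k) (Q o) * eval z (Q o) := by
        rw [Filter.eventually_all]
        intro o
        exact (hcts k o).continuousAt.eventually (lt_mem_nhds (hSpos k x hx hF o))
      filter_upwards [this] with z hz o using (hz o).le)
  choose δ hδ hcrit using hcrit
  obtain ⟨δ₀, hδ₀, hlt⟩ := aux_small δ hδ
  refine aux_bezout _ (fun i => pderiv i F) (fun i => (aux_totalDegree_pderiv F i).trans hFdeg)
    δ₀ hδ₀ ?_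
  intro y hy
  choose x hxS hxF hxy using fun k => hcrit k y (fun i => (hy i).trans (hlt k))
  refine ⟨x, ?_, hxy⟩
  intro k l hkl
  by_contra hne
  obtain ⟨i, hi⟩ := hsep k l hne
  have h1 := hSpos k _ (hxS k) (hxF k) (some i)
  have h2 := hSpos l _ (hxS l) (hxF l) (some i)
  rw [← hkl] at h2
  have h3 := mul_pos h1 h2
  change eval (u k) (P i) * eval (u l) (P i) < 0 at hi
  change 0 < eval (u k) (P i) * eval (x k) (P i) * (eval (u l) (P i) * eval (x k) (P i)) at h3
  nlinarith [sq_nonneg (eval (x k) (P i))]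

/-- Weak Warren bound for the patterns of nonnegativity. -/
theorem aux_nonstrict {σ ι κ : Type*} [Fintype σ] [Fintype ι] [Fintype κ] (d : ℕ)
    (P : ι → MvPolynomial σ ℝ) (hP : ∀ i, (P i).totalDegree ≤ d) (u : κ → σ → ℝ)
    (hsep : ∀ k l, k ≠ l → ∃ i, ¬ (0 ≤ eval (u k) (P i) ↔ 0 ≤ eval (u l) (P i))) :
    Fintype.card κ ≤ (Fintype.card σ * (2 + Fintype.card ι * d) + 2) ^ Fintype.card σ := by
  classical
  obtain ⟨ε, hε, hlt⟩ := aux_small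
    (fun a : κ × ι => if 0 ≤ eval (u a.1) (P a.2) then 1 else - eval (u a.1) (P a.2))
    (by
      intro a
      split_ifs with h
      · norm_num
      · linarith)
  have hpos : ∀ k i, 0 ≤ eval (u k) (P i) → 0 < eval (u k) (P i + C ε) := by
    intro k i h
    simp only [map_add, eval_C]
    linarith
  have hneg : ∀ k i, ¬ 0 ≤ eval (u k) (P i) → eval (u k) (P i + C ε) < 0 := by
    intro k i h
    have := hlt (k, i)
    simp only [h, if_false] at this
    simp only [map_add, eval_C]
    linarith
  refine aux_strict d (fun i => P i + C ε) (fun i => ?_) u ?_ ?_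
  · exact (totalDegree_add _ _).trans (max_le (hP i) (by simp))
  · intro k i
    by_cases h : 0 ≤ eval (u k) (P i)
    · exact (hpos k i h).ne'
    · exact (hneg k i h).ne
  · intro k l hkl
    obtain ⟨i, hi⟩ := hsep k l hkl
    refine ⟨i, ?_⟩
    by_cases h : 0 ≤ eval (u k) (P i) <;> by_cases h' : 0 ≤ eval (u l) (P i)
    · exact absurd (iff_of_true h h') hi
    · exact mul_neg_of_pos_of_neg (hpos k i h) (hneg l i h')
    · exact mul_neg_of_neg_of_pos (hneg k i h) (hpos l i h')
    · exact absurd (iff_of_false h h') hi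

open scoped UpperHalfPlane

theorem aux_dist (ρ : ℝ) (hρ : 0 < ρ) (z w : ℍ) : dist z w ≤ 2 * ρ ↔
    0 ≤ 2 * Real.cosh (2 * ρ) * z.im * w.im - (z.re - w.re) ^ 2 - z.im ^ 2 - w.im ^ 2 := by
  have hz := z.im_pos
  have hw := w.im_pos
  have h1 : dist z w ≤ 2 * ρ ↔ Real.cosh (dist z w) ≤ Real.cosh (2 * ρ) := by
    rw [Real.cosh_le_cosh, abs_of_nonneg dist_nonneg, abs_of_pos (by linarith)]
  rw [h1, UpperHalfPlane.cosh_dist', div_le_iff₀ (by positivity)]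
  constructor <;> intro h <;> nlinarith

/-- For every `ρ > 0` there is a constant `C > 0` such that for all `n ≥ 2`,
the number of simple graphs on `Fin n` admitting a radius-`ρ` uniform ball representation
in the hyperbolic plane `ℍ` is at most `2 ^ (C * n * log n)`. -/
theorem stmt_3 (ρ : ℝ) (hρ : 0 < ρ) :
    ∃ C : ℝ, 0 < C ∧ ∀ n : ℕ, 2 ≤ n →
      (Nat.card {G : SimpleGraph (Fin n) //
          ∃ η : Fin n → ℍ, ∀ v w : Fin n, v ≠ w →
            (G.Adj v w ↔ dist (η v) (η w) ≤ 2 * ρ)} : ℝ)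
        ≤ (2 : ℝ) ^ (C * n * Real.log n) := by
  classical
  have hlog2 : 0 < Real.log 2 := Real.log_pos (by norm_num)
  refine ⟨12 / Real.log 2, by positivity, fun n hn => ?_⟩
  set κ := {G : SimpleGraph (Fin n) //
          ∃ η : Fin n → ℍ, ∀ v w : Fin n, v ≠ w →
            (G.Adj v w ↔ dist (η v) (η w) ≤ 2 * ρ)} with hκ
  have : Fintype κ := Fintype.ofFinite κ
  choose η hη using fun G : κ => G.2
  let P : Fin n × Fin n → MvPolynomial (Fin n ⊕ Fin n) ℝ := fun a =>
    C (2 * Real.cosh (2 * ρ)) * X (Sum.inr a.1) * X (Sum.inr a.2)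
      - (X (Sum.inl a.1) - X (Sum.inl a.2)) ^ 2 - X (Sum.inr a.1) ^ 2 - X (Sum.inr a.2) ^ 2
  let u : κ → Fin n ⊕ Fin n → ℝ := fun G =>
    Sum.elim (fun v => (η G v).re) (fun v => (η G v).im)
  have hPu : ∀ G v w, 0 ≤ eval (u G) (P (v, w)) ↔ dist (η G v) (η G w) ≤ 2 * ρ := by
    intro G v w
    rw [aux_dist ρ hρ]
    simp [P, u]
  have hdeg : ∀ a, (P a).totalDegree ≤ 2 := by
    intro a
    refine (totalDegree_sub _ _).trans (max_le ?_ (by simp))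
    refine (totalDegree_sub _ _).trans (max_le ?_ (by simp))
    refine (totalDegree_sub _ _).trans (max_le ?_ ?_)
    · refine (totalDegree_mul _ _).trans ?_
      refine (add_le_add (totalDegree_mul _ _) le_rfl).trans ?_
      rw [totalDegree_C, totalDegree_X, totalDegree_X]
    · refine (totalDegree_pow _ _).trans ?_
      have : (X (Sum.inl a.1) - X (Sum.inl a.2) :
          MvPolynomial (Fin n ⊕ Fin n) ℝ).totalDegree ≤ 1 :=
        (totalDegree_sub _ _).trans (by simp)
      omega
  have hbound := aux_nonstrict 2 P hdeg u (by
    intro G H hGH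
    by_contra hcon
    push Not at hcon
    apply hGH
    apply Subtype.ext
    ext v w
    by_cases hvw : v = w
    · subst hvw
      simp
    · rw [hη G v w hvw, hη H v w hvw, ← hPu, ← hPu]
      exact hcon (v, w))
  simp only [Fintype.card_sum, Fintype.card_prod, Fintype.card_fin] at hbound
  have h6 : (n + n) * (2 + n * n * 2) + 2 ≤ n ^ 6 := by
    have h3 : 8 ≤ n ^ 3 := by
      calc 8 = 2 ^ 3 := by norm_num
        _ ≤ n ^ 3 := Nat.pow_le_pow_left hn 3
    have h4 : (n + n) * (2 + n * n * 2) + 2 ≤ 8 * n ^ 3 := by nlinarith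
    calc _ ≤ 8 * n ^ 3 := h4
      _ ≤ n ^ 3 * n ^ 3 := Nat.mul_le_mul_right _ h3
      _ = n ^ 6 := by ring
  have h7 : Nat.card κ ≤ n ^ (12 * n) := by
    rw [Nat.card_eq_fintype_card]
    calc _ ≤ _ := hbound
      _ ≤ (n ^ 6) ^ (n + n) := Nat.pow_le_pow_left h6 _
      _ = n ^ (12 * n) := by rw [← pow_mul]; congr 1; ring
  have hnpos : (0 : ℝ) < n := by exact_mod_cast (by omega : 0 < n)
  calc (Nat.card κ : ℝ) ≤ ((n ^ (12 * n) : ℕ) : ℝ) := by exact_mod_cast h7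
    _ = (n : ℝ) ^ ((12 * n : ℕ) : ℝ) := by rw [Real.rpow_natCast]; push_cast; rfl
    _ = (2 : ℝ) ^ (12 / Real.log 2 * n * Real.log n) := by
      rw [Real.rpow_def_of_pos hnpos, Real.rpow_def_of_pos (by norm_num)]
      congr 1
      push_cast
      field_simp
    _ ≤ _ := le_rfl
end

section
/- For every real s ≥ 1, the hyperbolic diameter of the square Q_s = {z ∈ ℍ : 0 ≤ Re z ≤ s and 1 ≤ Im z ≤ s+1} in the upper half-plane equals 2·arsinh(s/2), and this diameter is realized as the hyperbolic distance between the two corner points i and s + i. (Q_s is the base square of the nice tiling of the hyperbolic plane constructed in the half-plane model.) -/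
open scoped UpperHalfPlane

theorem aux_key (s x a b : ℝ) (hs : 1 ≤ s) (hx : x ^ 2 ≤ s ^ 2) (ha : 1 ≤ a) (hab : a ≤ b)
    (hb : b ≤ s + 1) : x ^ 2 + (a - b) ^ 2 ≤ s ^ 2 * (a * b) := by
  have h1 : b - a ≤ a * b - 1 := by nlinarith
  have h2 : b - a ≤ s ^ 2 := by nlinarith
  have h3 : 0 ≤ (b - a) * (s ^ 2 - (b - a)) := mul_nonneg (by linarith) (by linarith)
  nlinarith [mul_le_mul_of_nonneg_left h1 (sq_nonneg s)]

theorem aux_key' (s x a b : ℝ) (hs : 1 ≤ s) (hx : x ^ 2 ≤ s ^ 2) (ha : 1 ≤ a) (ha' : a ≤ s + 1)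
    (hb : 1 ≤ b) (hb' : b ≤ s + 1) : x ^ 2 + (a - b) ^ 2 ≤ s ^ 2 * (a * b) := by
  rcases le_total a b with h | h
  · exact aux_key s x a b hs hx ha h hb'
  · have := aux_key s x b a hs hx hb h ha'
    nlinarith

/-- For `s ≥ 1`, the hyperbolic diameter of the square
`Q_s = {z ∈ ℍ : 0 ≤ Re z ≤ s, 1 ≤ Im z ≤ s+1}` equals `2 · arsinh (s/2)`, and this
diameter is realized as the hyperbolic distance between the corners `i` and `s + i`. -/
theorem stmt_7 (s : ℝ) (hs : 1 ≤ s) :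
    Metric.diam {z : ℍ | 0 ≤ z.re ∧ z.re ≤ s ∧ 1 ≤ z.im ∧ z.im ≤ s + 1}
      = 2 * Real.arsinh (s / 2) ∧
    dist (⟨Complex.I, by simp⟩ : ℍ)
        (⟨(s : ℂ) + Complex.I, by simp⟩ : ℍ) = 2 * Real.arsinh (s / 2) := by
  have hd : dist (⟨Complex.I, by simp⟩ : ℍ)
        (⟨(s : ℂ) + Complex.I, by simp⟩ : ℍ) = 2 * Real.arsinh (s / 2) := by
    rw [UpperHalfPlane.dist_eq]
    simp [UpperHalfPlane.im, Complex.dist_eq, abs_of_nonneg (zero_le_one.trans hs)]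
  have hle : ∀ z ∈ {z : ℍ | 0 ≤ z.re ∧ z.re ≤ s ∧ 1 ≤ z.im ∧ z.im ≤ s + 1},
      ∀ w ∈ {z : ℍ | 0 ≤ z.re ∧ z.re ≤ s ∧ 1 ≤ z.im ∧ z.im ≤ s + 1},
      dist z w ≤ 2 * Real.arsinh (s / 2) := by
    rintro z ⟨h1, h2, h3, h4⟩ w ⟨k1, k2, k3, k4⟩
    have hx : (z.re - w.re) ^ 2 ≤ s ^ 2 := by
      apply sq_le_sq'  <;> linarith
    have key := aux_key' s _ z.im w.im hs hx h3 h4 k3 k4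
    have hp : 0 < z.im * w.im := mul_pos z.im_pos w.im_pos
    rw [UpperHalfPlane.dist_eq]
    gcongr 2 * ?_
    rw [Real.arsinh_le_arsinh, div_le_div_iff₀ (by positivity) two_pos]
    have : dist (z : ℂ) w ≤ s * √(z.im * w.im) := by
      rw [Complex.dist_eq_re_im]
      apply Real.sqrt_le_iff.2 ⟨by positivity, ?_⟩
      rw [mul_pow, Real.sq_sqrt hp.le]
      simpa using key
    linarith
  refine ⟨le_antisymm (Metric.diam_le_of_forall_dist_le ?_ hle) ?_, hd⟩
  · rw [← hd]; exact dist_nonneg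
  · rw [← hd]
    apply Metric.dist_le_diam_of_mem
    · exact Metric.isBounded_iff.2 ⟨_, fun z hz w hw => hle z hz w hw⟩
    · change 0 ≤ Complex.I.re ∧ Complex.I.re ≤ s ∧ 1 ≤ Complex.I.im ∧ Complex.I.im ≤ s + 1
      simp; linarith
    · change 0 ≤ ((s : ℂ) + Complex.I).re ∧ ((s : ℂ) + Complex.I).re ≤ s ∧
        1 ≤ ((s : ℂ) + Complex.I).im ∧ ((s : ℂ) + Complex.I).im ≤ s + 1
      simp; linarith
end
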